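/- The image of the discounted visit-count map F, over the set of all stationary policies, is contained in an affine subspace of ℝ^{S×A} of dimension |S|(|A|−1). -/

import Mathlib

open scoped BigOperators

/-- A rewardless MDP with finite state and action spaces: transition kernel `T`,
initial distribution `I`, and discount factor `γ ∈ (0,1)`. -/
structure MDPnr (S A : Type) [Fintype S] [Fintype A] where
  T : S → A → S → ℝ
  T_nonneg : ∀ s a s', 0 ≤ T s a s'
  T_sum : ∀ s a, ∑ s', T s a s' = 1
  I : S → ℝ
  I_nonneg : ∀ s, 0 ≤ I s
  I_sum : ∑ s, I s = 1
  γ : ℝ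
  γ_pos : 0 < γ
  γ_lt_one : γ < 1

variable {S A : Type} [Fintype S] [Fintype A]

/-- A stationary policy: a distribution over actions in each state. -/
def IsPolicy (π : S → A → ℝ) : Prop :=
  (∀ s a, 0 ≤ π s a) ∧ ∀ s, ∑ a, π s a = 1

/-- The set of all stationary policies. -/
def allPolicies (S A : Type) [Fintype S] [Fintype A] : Set (S → A → ℝ) :=
  {π | IsPolicy π}

/-- The distribution over states at time `t` induced by policy `π`. -/
def stateDist (M : MDPnr S A) (π : S → A → ℝ) : ℕ → S → ℝ
  | 0 => M.I
  | t + 1 => fun s' => ∑ s, ∑ a, stateDist M π t s * π s a * M.T s a s'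

/-- Discounted state-action visit counts `F(π)(s,a) = ∑ₜ γᵗ P(Sₜ = s, Aₜ = a)`. -/
noncomputable def visit (M : MDPnr S A) (π : S → A → ℝ) : S → A → ℝ :=
  fun s a => ∑' t : ℕ, M.γ ^ t * stateDist M π t s * π s a

/-- The visit counts viewed as a vector in `ℝ^{S×A}`. -/
noncomputable def Fvec (M : MDPnr S A) (π : S → A → ℝ) : S × A → ℝ :=
  fun p => visit M π p.1 p.2

/-- The value `J_R(π) = ∑_{s,a} R(s,a) F(π)(s,a)` of a policy `π` under reward `R`. -/
noncomputable def Jval (M : MDPnr S A) (R : S → A → ℝ) (π : S → A → ℝ) : ℝ :=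
  ∑ s, ∑ a, R s a * visit M π s a

/-- `R₁, R₂` are unhackable on policy set `P` if no pair of policies is ordered
oppositely by the two reward functions. -/
def Unhackable (M : MDPnr S A) (P : Set (S → A → ℝ)) (R₁ R₂ : S → A → ℝ) : Prop :=
  ¬ ∃ π ∈ P, ∃ π' ∈ P, Jval M R₁ π < Jval M R₁ π' ∧ Jval M R₂ π > Jval M R₂ π'

/-- `R₁, R₂` are equivalent on `P` if they induce the same preference ordering. -/
def EquivalentOn (M : MDPnr S A) (P : Set (S → A → ℝ)) (R₁ R₂ : S → A → ℝ) : Prop :=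
  ∀ π ∈ P, ∀ π' ∈ P, (Jval M R₁ π ≤ Jval M R₁ π' ↔ Jval M R₂ π ≤ Jval M R₂ π')

/-- `R` is trivial on `P` if its value function is constant on `P`. -/
def TrivialOn (M : MDPnr S A) (P : Set (S → A → ℝ)) (R : S → A → ℝ) : Prop :=
  ∀ π ∈ P, ∀ π' ∈ P, Jval M R π = Jval M R π'

/-- The embedding `G(π)(s,a) = π(a|s)` of policies into `ℝ^{S×A}`. -/
def Gmap (π : S → A → ℝ) : S × A → ℝ := fun p => π p.1 p.2

/-- A set of stationary policies is open if its image under `G` is open in the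
smallest affine subspace of `ℝ^{S×A}` containing the `G`-image of all policies. -/
def OpenPolicySet (Pd : Set (S → A → ℝ)) : Prop :=
  Pd ⊆ allPolicies S A ∧
  IsOpen {x : (affineSpan ℝ (Gmap '' allPolicies S A) : Set (S × A → ℝ)) |
    (x : S × A → ℝ) ∈ Gmap '' Pd}

/-- Every state is reachable (with positive probability) under some policy. -/
def AllReachable (M : MDPnr S A) : Prop :=
  ∀ s : S, ∃ π : S → A → ℝ, IsPolicy π ∧ ∃ t : ℕ, 0 < stateDist M π t s

/-- `R₂` is a simplification of `R₁` relative to `P`. -/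
def Simplification (M : MDPnr S A) (P : Set (S → A → ℝ)) (R₁ R₂ : S → A → ℝ) : Prop :=
  (∀ π ∈ P, ∀ π' ∈ P,
    (Jval M R₁ π < Jval M R₁ π' → Jval M R₂ π ≤ Jval M R₂ π') ∧
    (Jval M R₁ π = Jval M R₁ π' → Jval M R₂ π = Jval M R₂ π')) ∧
  ∃ π ∈ P, ∃ π' ∈ P, Jval M R₂ π = Jval M R₂ π' ∧ Jval M R₁ π ≠ Jval M R₁ π'

lemma stateDist_nonneg (M : MDPnr S A) {π : S → A → ℝ} (hπ : IsPolicy π) (t : ℕ) (s : S) :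
    0 ≤ stateDist M π t s := by
  induction t generalizing s with
  | zero => exact M.I_nonneg s
  | succ t ih =>
    exact Finset.sum_nonneg fun s _ => Finset.sum_nonneg fun a _ =>
      mul_nonneg (mul_nonneg (ih s) (hπ.1 s a)) (M.T_nonneg _ _ _)

lemma sum_stateDist (M : MDPnr S A) {π : S → A → ℝ} (hπ : IsPolicy π) (t : ℕ) :
    ∑ s, stateDist M π t s = 1 := by
  induction t with
  | zero => exact M.I_sum
  | succ t ih =>
    simp only [stateDist]
    rw [Finset.sum_comm]
    simp_rw [Finset.sum_comm (s := (Finset.univ : Finset S)) (t := (Finset.univ : Finset A)),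
      ← Finset.mul_sum, M.T_sum, mul_one]
    rw [Finset.sum_comm]
    simp_rw [← Finset.mul_sum, hπ.2, mul_one]
    exact ih

lemma summable_discounted_stateDist (M : MDPnr S A) {π : S → A → ℝ} (hπ : IsPolicy π) (s : S) :
    Summable fun t : ℕ => M.γ ^ t * stateDist M π t s := by
  refine Summable.of_nonneg_of_le
    (fun t => mul_nonneg (pow_nonneg M.γ_pos.le t) (stateDist_nonneg M hπ t s)) (fun t => ?_)
    (summable_geometric_of_lt_one M.γ_pos.le M.γ_lt_one)
  refine mul_le_of_le_one_right (pow_nonneg M.γ_pos.le t) ?_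
  rw [← sum_stateDist M hπ t]
  exact Finset.single_le_sum (fun s _ => stateDist_nonneg M hπ t s) (Finset.mem_univ s)

/-- The Bellman flow map: the discounted outflow minus the discounted inflow at each state. -/
def flowMap (M : MDPnr S A) : (S × A → ℝ) →ₗ[ℝ] (S → ℝ) where
  toFun x s' := ∑ a, x (s', a) - M.γ * ∑ s, ∑ a, x (s, a) * M.T s a s'
  map_add' x y := by
    ext s'
    simp only [Pi.add_apply, add_mul, Finset.sum_add_distrib]
    ring
  map_smul' c x := by
    ext s'
    simp only [Pi.smul_apply, smul_eq_mul, RingHom.id_apply, mul_assoc, ← Finset.mul_sum]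
    ring

lemma flowMap_Fvec (M : MDPnr S A) {π : S → A → ℝ} (hπ : IsPolicy π) :
    flowMap M (Fvec M π) = M.I := by
  ext s'
  have hsum := summable_discounted_stateDist M hπ
  have hvisit (s : S) (a : A) :
      Fvec M π (s, a) = (∑' t : ℕ, M.γ ^ t * stateDist M π t s) * π s a := by
    simp only [Fvec, visit, tsum_mul_right]
  have hflow : ∑' t : ℕ, M.γ ^ (t + 1) * stateDist M π (t + 1) s' =
      M.γ * ∑ s, ∑ a, (∑' t : ℕ, M.γ ^ t * stateDist M π t s) * π s a * M.T s a s' := by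
    have h := (hasSum_sum fun s (_ : s ∈ Finset.univ) => hasSum_sum fun a (_ : a ∈ Finset.univ) =>
      ((hsum s).hasSum.mul_right (π s a)).mul_right (M.T s a s')).mul_left M.γ
    rw [← h.tsum_eq]
    refine tsum_congr fun t => ?_
    simp only [stateDist, Finset.mul_sum, pow_succ]
    exact Finset.sum_congr rfl fun s _ => Finset.sum_congr rfl fun a _ => by ring
  have hd := (hsum s').tsum_eq_zero_add
  rw [hflow, pow_zero, one_mul] at hd
  simp only [flowMap, LinearMap.coe_mk, AddHom.coe_mk, hvisit]
  rw [← Finset.mul_sum, hπ.2, mul_one, hd]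
  simp [stateDist]

/-- The flow map is onto: restricted to a single action, it is a perturbation of the identity by a
map of `ℓ¹`-norm at most `γ < 1`. -/
lemma flowMap_surjective (M : MDPnr S A) [Nonempty A] : Function.Surjective (flowMap M) := by
  classical
  obtain ⟨a₀⟩ := ‹Nonempty A›
  let E : (S → ℝ) →ₗ[ℝ] (S × A → ℝ) :=
    { toFun := fun y p => if p.2 = a₀ then y p.1 else 0
      map_add' := fun x y => by ext p; by_cases h : p.2 = a₀ <;> simp [h]
      map_smul' := fun c x => by ext p; by_cases h : p.2 = a₀ <;> simp [h] }
  have hE (y : S → ℝ) (s' : S) :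
      flowMap M (E y) s' = y s' - M.γ * ∑ s, y s * M.T s a₀ s' := by
    simp [flowMap, E, ite_mul]
  have hinj : Function.Injective (flowMap M ∘ₗ E) := by
    rw [← LinearMap.ker_eq_bot, LinearMap.ker_eq_bot']
    intro y hy
    have hfix (s' : S) : y s' = M.γ * ∑ s, y s * M.T s a₀ s' := by
      have h := congrFun hy s'
      rw [LinearMap.comp_apply, hE, Pi.zero_apply] at h
      linarith
    have hle : ∑ s', |y s'| ≤ M.γ * ∑ s, |y s| := calc
      ∑ s', |y s'| ≤ ∑ s', M.γ * ∑ s, |y s| * M.T s a₀ s' := by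
        refine Finset.sum_le_sum fun s' _ => ?_
        rw [hfix s', abs_mul, abs_of_pos M.γ_pos]
        refine mul_le_mul_of_nonneg_left ((Finset.abs_sum_le_sum_abs _ _).trans_eq ?_) M.γ_pos.le
        exact Finset.sum_congr rfl fun s _ => by rw [abs_mul, abs_of_nonneg (M.T_nonneg _ _ _)]
      _ = M.γ * ∑ s, |y s| := by
        rw [← Finset.mul_sum, Finset.sum_comm]
        simp_rw [← Finset.mul_sum, M.T_sum, mul_one]
    have hnonneg : 0 ≤ ∑ s, |y s| := Finset.sum_nonneg fun s _ => abs_nonneg _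
    have hzero : ∑ s, |y s| = 0 := by nlinarith [M.γ_lt_one]
    ext s
    exact abs_eq_zero.1
      ((Finset.sum_eq_zero_iff_of_nonneg fun s _ => abs_nonneg (y s)).1 hzero s (Finset.mem_univ s))
  exact Function.Surjective.of_comp (g := E) (LinearMap.injective_iff_surjective.1 hinj)

/-- The image of the discounted visit-count map over all stationary
policies is contained in an affine subspace of `ℝ^{S×A}` of dimension `|S|(|A|−1)`. -/
theorem visit_image_in_affine_subspace
    (M : MDPnr S A) (hA : 1 < Fintype.card A) :
    ∃ V : AffineSubspace ℝ (S × A → ℝ),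
      Module.finrank ℝ V.direction = Fintype.card S * (Fintype.card A - 1) ∧
      ∀ π : S → A → ℝ, IsPolicy π → Fvec M π ∈ V := by
  have : Nonempty A := Fintype.card_pos_iff.1 (by omega)
  have hsurj := flowMap_surjective M
  obtain ⟨x₀, hx₀⟩ := hsurj M.I
  refine ⟨AffineSubspace.mk' x₀ (LinearMap.ker (flowMap M)), ?_, fun π hπ => ?_⟩
  · rw [AffineSubspace.direction_mk']
    have h := LinearMap.finrank_range_add_finrank_ker (flowMap M)
    rw [LinearMap.range_eq_top.2 hsurj, finrank_top, Module.finrank_fintype_fun_eq_card,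
      Module.finrank_fintype_fun_eq_card, Fintype.card_prod] at h
    rw [Nat.mul_sub, mul_one]
    omega
  · rw [AffineSubspace.mem_mk', vsub_eq_sub, LinearMap.mem_ker, map_sub, flowMap_Fvec M hπ, hx₀,
      sub_self]
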